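/- For every integer n ≥ 1: if n is odd, then P²_p(n+1) − P¹_x(n) = 0; if n is even, then P²_p(n+1) − P¹_x(n) = Δ₀(n)/2 + 1 − JM₀(n) − jm₀(n). -/

import Mathlib

/-- The 2-kernel of a sequence `s : ℕ → ℤ`. -/
def kernel2 (s : ℕ → ℤ) : Set (ℕ → ℤ) :=
  {t | ∃ i j : ℕ, j < 2 ^ i ∧ t = fun n => s (2 ^ i * n + j)}

/-- A sequence is 2-regular if the ℤ-module spanned by its 2-kernel is finitely generated. -/
def IsTwoRegular (s : ℕ → ℤ) : Prop :=
  (Submodule.span ℤ (kernel2 s)).FG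

/-- A sequence is 2-automatic if its 2-kernel is finite. -/
def IsTwoAutomatic (s : ℕ → ℤ) : Prop :=
  (kernel2 s).Finite

/-- The period-doubling word, fixed point (starting with 0) of 0 ↦ 01, 1 ↦ 00:
its `n`-th letter is the parity of the 2-adic valuation of `n+1`. -/
def pd (n : ℕ) : ℕ := (n + 1).factorization 2 % 2

/-- The Thue–Morse word, fixed point (starting with 0) of 0 ↦ 01, 1 ↦ 10:
its `n`-th letter is the parity of the binary digit sum of `n`. -/
def tm (n : ℕ) : ℕ := (Nat.digits 2 n).sum % 2

/-- The 2-block coding `x = block(p, 2)` of the period-doubling word. -/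
def xw (n : ℕ) : ℕ := 2 * pd n + pd (n + 1)

/-- The 2-block coding `y = block(t, 2)` of the Thue–Morse word. -/
def yw (n : ℕ) : ℕ := 2 * tm n + tm (n + 1)

/-- The factor of an infinite word `w` of length `len` occurring at position `i`. -/
def factorAt (w : ℕ → ℕ) (i len : ℕ) : List ℕ :=
  (List.range len).map fun k => w (i + k)

/-- `u` is a factor of the infinite word `w`. -/
def IsFactor (w : ℕ → ℕ) (u : List ℕ) : Prop :=
  ∃ i, u = factorAt w i u.length

/-- Maximal number of 0's in a factor of `x` of length `n`. -/
noncomputable def M0 (n : ℕ) : ℕ := sSup {k | ∃ i, (factorAt xw i n).count 0 = k}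

/-- Minimal number of 0's in a factor of `x` of length `n`. -/
noncomputable def m0 (n : ℕ) : ℕ := sInf {k | ∃ i, (factorAt xw i n).count 0 = k}

noncomputable def D0 (n : ℕ) : ℕ := M0 n - m0 n

/-- Maximal number of 2's in a factor of `x` of length `n`. -/
noncomputable def M2c (n : ℕ) : ℕ := sSup {k | ∃ i, (factorAt xw i n).count 2 = k}

/-- Minimal number of 2's in a factor of `x` of length `n`. -/
noncomputable def m2c (n : ℕ) : ℕ := sInf {k | ∃ i, (factorAt xw i n).count 2 = k}

/-- The max-jump function for `M0`. -/
noncomputable def JM0 : ℕ → ℕ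
  | 0 => 0
  | n + 1 => if M0 n < M0 (n + 1) then 1 else 0

/-- The min-jump function for `m0`. -/
noncomputable def jm0 (n : ℕ) : ℕ := if m0 n < m0 (n + 1) then 1 else 0

/-- Maximal total number of 1's and 2's in a factor of `y` of length `n`. -/
noncomputable def M12 (n : ℕ) : ℕ :=
  sSup {k | ∃ i, (factorAt yw i n).count 1 + (factorAt yw i n).count 2 = k}

/-- Minimal total number of 1's and 2's in a factor of `y` of length `n`. -/
noncomputable def m12 (n : ℕ) : ℕ :=
  sInf {k | ∃ i, (factorAt yw i n).count 1 + (factorAt yw i n).count 2 = k}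

noncomputable def D12 (n : ℕ) : ℕ := M12 n - m12 n

/-- Maximal total number of 0's and 3's in a factor of `y` of length `n`. -/
noncomputable def M03 (n : ℕ) : ℕ :=
  sSup {k | ∃ i, (factorAt yw i n).count 0 + (factorAt yw i n).count 3 = k}

/-- Minimal total number of 0's and 3's in a factor of `y` of length `n`. -/
noncomputable def m03 (n : ℕ) : ℕ :=
  sInf {k | ∃ i, (factorAt yw i n).count 0 + (factorAt yw i n).count 3 = k}

/-- The max-jump function for `M03`. -/
noncomputable def JM03 (n : ℕ) : ℕ := if M03 (n - 1) < M03 n then 1 else 0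

/-- The min-jump function for `m03`. -/
noncomputable def jm03 (n : ℕ) : ℕ := if m03 n < m03 (n + 1) then 1 else 0

/-- Abelian complexity: the number of abelian equivalence classes (i.e. distinct
multisets of letters) of factors of `w` of length `n`. -/
noncomputable def abComplexity (w : ℕ → ℕ) (n : ℕ) : ℕ :=
  Set.ncard {m : Multiset ℕ | ∃ i, (↑(factorAt w i n) : Multiset ℕ) = m}

/-- The number of occurrences of `v` as a factor of `u`. -/
def countFactor (u v : List ℕ) : ℕ :=
  ((List.range (u.length + 1 - v.length)).filter
    fun i => decide ((u.drop i).take v.length = v)).length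

/-- 2-abelian complexity: the number of 2-abelian equivalence classes of factors of `w`
of length `n`, where two words are 2-abelian equivalent when every word of length at most 2
occurs equally often in both. -/
noncomputable def abel2Complexity (w : ℕ → ℕ) (n : ℕ) : ℕ :=
  Set.ncard {f : List ℕ → ℕ |
    ∃ i, f = fun v => if v.length ≤ 2 then countFactor (factorAt w i n) v else 0}

/-- The morphism φ : 0 ↦ 12, 1 ↦ 12, 2 ↦ 00. -/
def phiL : ℕ → List ℕ
  | 0 => [1, 2]
  | 1 => [1, 2]
  | 2 => [0, 0]
  | _ => []

/-- The morphism τ : 0 ↦ 0, 1 ↦ 2, 2 ↦ 1. -/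
def tauL : ℕ → ℕ
  | 1 => 2
  | 2 => 1
  | n => n

open Finset

/-! ### Generalities on factors and cardinalities -/

theorem factorAt_succ (w : ℕ → ℕ) (i n : ℕ) :
    factorAt w i (n + 1) = factorAt w i n ++ [w (i + n)] := by
  simp [factorAt, List.range_succ]

theorem length_factorAt (w : ℕ → ℕ) (i n : ℕ) : (factorAt w i n).length = n := by
  simp [factorAt]

theorem count_factorAt (w : ℕ → ℕ) (i n a : ℕ) :
    (factorAt w i n).count a = ∑ k ∈ range n, if w (i + k) = a then 1 else 0 := by
  induction n with
  | zero => simp [factorAt]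
  | succ n ih =>
    rw [factorAt_succ, List.count_append, ih, sum_range_succ, List.count_singleton]
    simp

theorem take_drop_factorAt (w : ℕ → ℕ) {i n k l : ℕ} (h : k + l ≤ n) :
    ((factorAt w i n).drop k).take l = factorAt w (i + k) l := by
  apply List.ext_getElem
  · simp only [List.length_take, List.length_drop, length_factorAt]
    omega
  · intro r _ _
    simp [factorAt, Nat.add_assoc]

theorem countFactor_factorAt (w : ℕ → ℕ) (i n : ℕ) (v : List ℕ) :
    countFactor (factorAt w i n) v =
      ∑ k ∈ range (n + 1 - v.length), if factorAt w (i + k) v.length = v then 1 else 0 := by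
  have key : ∀ L, L ≤ n + 1 - v.length →
      ((List.range L).filter fun k =>
        decide (((factorAt w i n).drop k).take v.length = v)).length =
      ∑ k ∈ range L, if factorAt w (i + k) v.length = v then 1 else 0 := by
    intro L
    induction L with
    | zero => simp
    | succ L ih =>
      intro hL
      have hd : ((factorAt w i n).drop L).take v.length = factorAt w (i + L) v.length :=
        take_drop_factorAt w (by omega)
      rw [List.range_succ, List.filter_append, List.length_append, ih (by omega),
        sum_range_succ]
      congr 1
      by_cases h : factorAt w (i + L) v.length = v <;> simp [hd, h]
  rw [countFactor, length_factorAt]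
  exact key _ le_rfl

theorem ncard_image_eq_of_eq_iff {ι α β : Type*} {f : ι → α} {g : ι → β} {S : Set ι}
    (h : ∀ i ∈ S, ∀ j ∈ S, f i = f j ↔ g i = g j) : (f '' S).ncard = (g '' S).ncard := by
  obtain ⟨T, hTS, hT⟩ := Set.exists_subset_bijOn S f
  have hg : Set.InjOn g T := fun i hi j hj hij =>
    hT.injOn hi hj ((h i (hTS hi) j (hTS hj)).2 hij)
  have himg : g '' S = g '' T := by
    refine Set.Subset.antisymm ?_ (Set.image_mono hTS)
    rintro _ ⟨i, hi, rfl⟩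
    obtain ⟨j, hj, hij⟩ := hT.surjOn (Set.mem_image_of_mem f hi)
    exact ⟨j, hj, (h j (hTS hj) i hi).1 hij⟩
  rw [← hT.image_eq, himg, hT.injOn.ncard_image, hg.ncard_image]

/-- If `f` refines `g` by the predicate `E`, and every `g`-class meets the complement of `E`,
then `f` has as many extra classes as there are `g`-classes meeting `E`. -/
theorem ncard_range_of_refinement {ι α β : Type*} {f : ι → α} {g : ι → β} {E : Set ι}
    (hfin : (Set.range f).Finite)
    (h : ∀ i j, f i = f j ↔ g i = g j ∧ (i ∈ E ↔ j ∈ E))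
    (hE : ∀ i ∈ E, ∃ j ∉ E, g j = g i) :
    (Set.range f).ncard = (Set.range g).ncard + (g '' E).ncard := by
  have hsplit : Set.range f = f '' Eᶜ ∪ f '' E := by
    rw [← Set.image_union, Set.compl_union_self, Set.image_univ]
  have hdisj : Disjoint (f '' Eᶜ) (f '' E) := by
    rw [Set.disjoint_left]
    rintro _ ⟨i, hi, rfl⟩ ⟨j, hj, hij⟩
    exact hi (((h j i).1 hij).2.1 hj)
  have hg : Set.range g = g '' Eᶜ := by
    refine Set.Subset.antisymm ?_ (Set.image_subset_range _ _)
    rintro _ ⟨i, rfl⟩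
    by_cases hi : i ∈ E
    · obtain ⟨j, hj, hij⟩ := hE i hi
      exact ⟨j, hj, hij⟩
    · exact ⟨i, hi, rfl⟩
  rw [hsplit, Set.ncard_union_eq hdisj (hfin.subset (Set.image_subset_range _ _))
    (hfin.subset (Set.image_subset_range _ _)), hg]
  congr 1
  · refine ncard_image_eq_of_eq_iff fun i hi j hj => ?_
    rw [h]
    exact and_iff_left (iff_of_false hi hj)
  · refine ncard_image_eq_of_eq_iff fun i hi j hj => ?_
    rw [h]
    exact and_iff_left (iff_of_true hi hj)

/-- A walk on `ℕ` climbing by at most one per step steps from `c` to `c + 1` when it passes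
from a value `≤ c` to a later value `> c`. -/
theorem exists_step_of_le_of_lt {u : ℕ → ℕ} (hu : ∀ j, u (j + 1) ≤ u j + 1) {c s t : ℕ}
    (hst : s ≤ t) (hs : u s ≤ c) (ht : c < u t) : ∃ j, u j = c ∧ u (j + 1) = c + 1 := by
  induction t, hst using Nat.le_induction with
  | base => omega
  | succ t _ ih =>
    by_cases h : c < u t
    · exact ih h
    · have := hu t
      exact ⟨t, by omega, by omega⟩

/-! ### The period-doubling word -/

theorem pd_le_one (n : ℕ) : pd n ≤ 1 := by
  unfold pd
  omega

theorem pd_two_mul (n : ℕ) : pd (2 * n) = 0 := by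
  unfold pd
  rw [Nat.factorization_eq_zero_of_not_dvd (by omega)]

theorem pd_two_mul_add_one (n : ℕ) : pd (2 * n + 1) + pd n = 1 := by
  have h : 2 * n + 1 + 1 = 2 * (n + 1) := by ring
  unfold pd
  rw [h, Nat.factorization_mul two_ne_zero (by omega), Finsupp.add_apply,
    Nat.prime_two.factorization_self]
  omega

theorem pd_add_pd_succ_le_one (n : ℕ) : pd n + pd (n + 1) ≤ 1 := by
  have h1 := pd_le_one n
  have h2 := pd_le_one (n + 1)
  obtain ⟨k, rfl | rfl⟩ := n.even_or_odd'
  · have := pd_two_mul k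
    omega
  · have := pd_two_mul (k + 1)
    rw [show 2 * k + 1 + 1 = 2 * (k + 1) by ring]
    omega

theorem pd_two_pow_add {K n : ℕ} (h : n + 1 < 2 ^ K) : pd (2 ^ K + n) = pd n := by
  induction K generalizing n with
  | zero => simp at h
  | succ K ih =>
    rw [pow_succ] at h ⊢
    obtain ⟨k, rfl | rfl⟩ := n.even_or_odd'
    · rw [show 2 ^ K * 2 + 2 * k = 2 * (2 ^ K + k) by ring, pd_two_mul, pd_two_mul]
    · have h1 := pd_two_mul_add_one (2 ^ K + k)
      have h2 := pd_two_mul_add_one k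
      have h3 := ih (n := k) (by omega)
      rw [show 2 ^ K * 2 + (2 * k + 1) = 2 * (2 ^ K + k) + 1 by ring]
      omega

/-- Every prefix of the period-doubling word occurs arbitrarily far. -/
theorem exists_prefix_recurrence (L T : ℕ) : ∃ d, T ≤ d ∧ ∀ k < L, pd (d + k) = pd k := by
  refine ⟨2 ^ (L + T + 1), ?_, fun k hk => pd_two_pow_add ?_⟩
  · have := (L + T + 1).lt_two_pow_self
    omega
  · have := (L + T + 1).lt_two_pow_self
    omega

/-- The number of letters `1` in the factor of length `m` at position `j` of `pd`. -/
def onesCount (m j : ℕ) : ℕ := ∑ k ∈ range m, pd (j + k)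

theorem onesCount_succ (m j : ℕ) : onesCount (m + 1) j = onesCount m j + pd (j + m) :=
  sum_range_succ _ _

theorem onesCount_succ' (m j : ℕ) : onesCount (m + 1) j = onesCount m (j + 1) + pd j := by
  simp only [onesCount, sum_range_succ', add_zero]
  congr 1
  refine sum_congr rfl fun k _ => ?_
  rw [show j + (k + 1) = j + 1 + k by ring]

theorem onesCount_shift (m j : ℕ) :
    onesCount m (j + 1) + pd j = onesCount m j + pd (j + m) := by
  rw [← onesCount_succ, onesCount_succ']

theorem onesCount_le (m j : ℕ) : onesCount m j ≤ m := by
  simpa [onesCount] using sum_le_card_nsmul (range m) _ 1 fun k _ => pd_le_one (j + k)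

theorem onesCount_two_mul (r l : ℕ) : onesCount (2 * r) (2 * l) + onesCount r l = r := by
  induction r with
  | zero => simp [onesCount]
  | succ r ih =>
    have h1 := pd_two_mul (l + r)
    have h2 := pd_two_mul_add_one (l + r)
    rw [show 2 * (r + 1) = 2 * r + 1 + 1 by ring, onesCount_succ, onesCount_succ,
      onesCount_succ, show 2 * l + 2 * r = 2 * (l + r) by ring,
      show 2 * l + (2 * r + 1) = 2 * (l + r) + 1 by ring]
    omega

theorem exists_onesCount_eq_of_le (m j T : ℕ) :
    ∃ d, T ≤ d ∧ onesCount m (d + j) = onesCount m j ∧ ∀ k ≤ j + m, pd (d + k) = pd k := by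
  obtain ⟨d, hd, h⟩ := exists_prefix_recurrence (j + m + 1) T
  refine ⟨d, hd, sum_congr rfl fun k hk => ?_, fun k hk => h k (by omega)⟩
  rw [mem_range] at hk
  rw [add_assoc]
  exact h _ (by omega)

theorem exists_onesCount_min (m : ℕ) : ∃ s, ∀ j, onesCount m s ≤ onesCount m j := by
  obtain ⟨_, ⟨s, rfl⟩, h⟩ := wellFounded_lt.has_min (Set.range (onesCount m)) ⟨_, 0, rfl⟩
  exact ⟨s, fun j => not_lt.1 (h _ ⟨j, rfl⟩)⟩

theorem exists_onesCount_max (m : ℕ) : ∃ t, ∀ j, onesCount m j ≤ onesCount m t := by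
  have hfin : (Set.range (onesCount m)).Finite :=
    (Set.finite_Iic m).subset (by rintro _ ⟨j, rfl⟩; exact onesCount_le m j)
  obtain ⟨_, ⟨t, rfl⟩, h⟩ := hfin.exists_maximal ⟨_, 0, rfl⟩
  exact ⟨t, fun j => (le_total _ _).elim id fun hle => h ⟨j, rfl⟩ hle⟩

theorem onesCount_step (m j : ℕ) : onesCount m (j + 1) ≤ onesCount m j + 1 := by
  have := onesCount_shift m j
  have := pd_le_one (j + m)
  omega

theorem exists_onesCount_up_step {m c s t : ℕ} (hs : onesCount m s ≤ c)
    (ht : c < onesCount m t) : ∃ j, onesCount m j = c ∧ onesCount m (j + 1) = c + 1 := by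
  obtain ⟨d, hd, h, -⟩ := exists_onesCount_eq_of_le m t s
  exact exists_step_of_le_of_lt (onesCount_step m) (le_add_right hd) hs (h ▸ ht)

theorem onesCount_not_const {m s t : ℕ} (hm : 1 ≤ m) (hs : ∀ j, onesCount m s ≤ onesCount m j)
    (ht : ∀ j, onesCount m j ≤ onesCount m t) : onesCount m s < onesCount m t := by
  by_contra hlt
  have h1 := onesCount_shift m (m - 1)
  have h2 := pd_two_mul_add_one (m - 1)
  rw [show m - 1 + m = 2 * (m - 1) + 1 by omega, show m - 1 + 1 = m by omega] at h1
  have := hs m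
  have := hs (m - 1)
  have := ht m
  have := ht (m - 1)
  omega

/-- The numbers of letters `1` in the factors of length `m` of `pd` that start with `0` and are
followed by `0`. -/
def flatCounts (m : ℕ) : Set ℕ := onesCount m '' {j | pd j = 0 ∧ pd (j + m) = 0}

theorem mem_flatCounts_of_lt_of_lt {m c s t : ℕ} (hs : onesCount m s < c)
    (ht : c < onesCount m t) : c ∈ flatCounts m := by
  obtain ⟨r, rfl | rfl⟩ := m.even_or_odd'
  · obtain ⟨j, hj, hj'⟩ := exists_onesCount_up_step hs.le ht
    obtain ⟨l, rfl | rfl⟩ := j.even_or_odd'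
    · exact ⟨2 * l, ⟨pd_two_mul l, by rw [← mul_add, pd_two_mul]⟩, hj⟩
    · have h1 := onesCount_shift (2 * r) (2 * l)
      have h2 := pd_two_mul l
      have h3 := pd_two_mul (l + r)
      rw [show 2 * l + 2 * r = 2 * (l + r) by ring] at h1
      refine ⟨2 * l, ⟨h2, by rw [← mul_add, h3]⟩, by omega⟩
  · -- `c` is attained at position `2 * j` when the walk for `r` steps up from `r - c` at `j`
    have bound : ∀ j, ∃ l, onesCount (2 * r + 1) j + onesCount r l ≤ r + 1 ∧
        ∃ l', r ≤ onesCount (2 * r + 1) j + onesCount r l' := by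
      intro j
      obtain ⟨l, rfl | rfl⟩ := j.even_or_odd'
      · have h1 := onesCount_two_mul r l
        have h2 := pd_two_mul (l + r)
        rw [onesCount_succ, ← mul_add, h2]
        exact ⟨l, by omega, l, by omega⟩
      · have h1 := onesCount_two_mul (r + 1) l
        have h2 := pd_two_mul l
        have h3 := onesCount_succ' (2 * r + 1) (2 * l)
        have h4 := onesCount_succ r l
        have h5 := pd_le_one (l + r)
        rw [show 2 * (r + 1) = 2 * r + 1 + 1 by ring] at h1
        exact ⟨l, by omega, l, by omega⟩
    obtain ⟨_, _, l', hl'⟩ := bound s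
    obtain ⟨l, hl, _⟩ := bound t
    obtain ⟨j, hj, hj'⟩ := exists_onesCount_up_step (m := r) (c := r - c) (s := l) (t := l')
      (by omega) (by omega)
    have h1 := onesCount_shift r j
    have h2 := pd_le_one (j + r)
    have h3 := onesCount_two_mul r j
    have h4 := pd_two_mul (j + r)
    have h5 := pd_two_mul_add_one (j + r)
    refine ⟨2 * j, ⟨pd_two_mul j, ?_⟩, ?_⟩
    · rw [show 2 * j + (2 * r + 1) = 2 * (j + r) + 1 by ring]
      omega
    · rw [onesCount_succ, ← mul_add, h4]
      have := onesCount_le r l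
      omega

theorem max_mem_flatCounts_iff {m t : ℕ} (ht : ∀ j, onesCount (m + 1) j ≤ onesCount (m + 1) t) :
    onesCount (m + 1) t ∈ flatCounts (m + 1) ↔
      ∃ j, onesCount (m + 1) j = onesCount (m + 1) t ∧ (pd j = 0 ∨ pd (j + m) = 0) := by
  constructor
  · rintro ⟨j, ⟨h0, -⟩, h⟩
    exact ⟨j, h, Or.inl h0⟩
  · rintro ⟨j, h, h0 | h0⟩
    · have := onesCount_shift (m + 1) j
      have := ht (j + 1)
      exact ⟨j, ⟨h0, by omega⟩, h⟩
    · obtain ⟨d, hd, hd', hpd⟩ := exists_onesCount_eq_of_le (m + 1) j 1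
      have h1 := onesCount_shift (m + 1) (d + j - 1)
      have h2 := ht (d + j - 1)
      have h3 := hpd (j + m) (by omega)
      rw [show d + j - 1 + 1 = d + j by omega,
        show d + j - 1 + (m + 1) = d + (j + m) by omega] at h1
      refine ⟨d + j - 1, ⟨by omega, ?_⟩, by omega⟩
      rw [show d + j - 1 + (m + 1) = d + (j + m) by omega]
      omega

theorem min_mem_flatCounts_iff {m s : ℕ} (hs : ∀ j, onesCount m s ≤ onesCount m j) :
    onesCount m s ∈ flatCounts m ↔
      ∃ j, (onesCount m j = onesCount m s ∧ pd (j + m) = 0) ∨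
        (onesCount m (j + 1) = onesCount m s ∧ pd j = 0) := by
  constructor
  · rintro ⟨j, ⟨-, h0⟩, h⟩
    exact ⟨j, Or.inl ⟨h, h0⟩⟩
  · rintro ⟨j, ⟨h, h0⟩ | ⟨h, h0⟩⟩ <;>
    · have := onesCount_shift m j
      have := hs j
      have := hs (j + 1)
      exact ⟨j, ⟨by omega, by omega⟩, by omega⟩

open Classical in
theorem ncard_flatCounts {m s t : ℕ} (hm : 1 ≤ m) (hs : ∀ j, onesCount m s ≤ onesCount m j)
    (ht : ∀ j, onesCount m j ≤ onesCount m t) :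
    (flatCounts m).ncard + 1 + onesCount m s = onesCount m t +
      (if onesCount m s ∈ flatCounts m then 1 else 0) +
      (if onesCount m t ∈ flatCounts m then 1 else 0) := by
  have hlt := onesCount_not_const hm hs ht
  generalize ha : onesCount m s = a at *
  generalize hb : onesCount m t = b at *
  have hset : flatCounts m = ((Finset.Ioo a b ∪ (if a ∈ flatCounts m then {a} else ∅)) ∪
      (if b ∈ flatCounts m then {b} else ∅) : Finset ℕ) := by
    ext c
    have hc : c ∈ flatCounts m → a ≤ c ∧ c ≤ b := by
      rintro ⟨j, -, rfl⟩
      exact ⟨hs j, ht j⟩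
    have hc' : a < c → c < b → c ∈ flatCounts m := fun h1 h2 =>
      mem_flatCounts_of_lt_of_lt (ha ▸ h1) (hb ▸ h2)
    rcases lt_trichotomy c a with h | rfl | h
    · have : c ∉ flatCounts m := fun h' => by have := hc h'; omega
      split_ifs <;> simp [this] <;> omega
    · by_cases hcm : c ∈ flatCounts m <;> split_ifs <;> (simp [hcm]; try omega)
    · rcases lt_trichotomy c b with h' | rfl | h'
      · simp [hc' h h', h, h']
      · by_cases hcm : c ∈ flatCounts m <;> split_ifs <;> (simp [hcm]; try omega)
      · have : c ∉ flatCounts m := fun h'' => by have := hc h''; omega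
        split_ifs <;> simp [this] <;> omega
  rw [congrArg Set.ncard hset, Set.ncard_coe_finset, card_union_of_disjoint,
    card_union_of_disjoint, Nat.card_Ioo]
  · split_ifs <;> simp <;> omega
  · split_ifs <;> simp
  · split_ifs <;> (simp; try omega)

/-! ### Letter counts in the 2-block coding -/

theorem count_zero_xw_succ (i n : ℕ) : (factorAt xw i (n + 1)).count 0 =
    (factorAt xw i n).count 0 + if xw (i + n) = 0 then 1 else 0 := by
  simp only [count_factorAt, sum_range_succ]

theorem count_two_xw (i n : ℕ) : (factorAt xw i n).count 2 = onesCount n i := by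
  rw [count_factorAt, onesCount]
  refine sum_congr rfl fun k _ => ?_
  have := pd_add_pd_succ_le_one (i + k)
  have hx : xw (i + k) = 2 * pd (i + k) + pd (i + k + 1) := rfl
  split_ifs <;> omega

theorem count_one_xw (i n : ℕ) : (factorAt xw i n).count 1 = onesCount n (i + 1) := by
  rw [count_factorAt, onesCount]
  refine sum_congr rfl fun k _ => ?_
  have := pd_add_pd_succ_le_one (i + k)
  have hx : xw (i + k) = 2 * pd (i + k) + pd (i + k + 1) := rfl
  rw [show i + 1 + k = i + k + 1 by ring]
  split_ifs <;> omega

theorem count_zero_xw_add (i n : ℕ) :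
    (factorAt xw i n).count 0 + onesCount n i + onesCount n (i + 1) = n := by
  induction n with
  | zero => simp [factorAt, onesCount]
  | succ n ih =>
    have := pd_add_pd_succ_le_one (i + n)
    rw [count_zero_xw_succ, onesCount_succ, onesCount_succ, show i + 1 + n = i + n + 1 by ring]
    have hx : xw (i + n) = 2 * pd (i + n) + pd (i + n + 1) := rfl
    split_ifs <;> omega

theorem count_xw_of_three_le {a : ℕ} (ha : 3 ≤ a) (i n : ℕ) : (factorAt xw i n).count a = 0 := by
  rw [count_factorAt]
  refine sum_eq_zero fun k _ => if_neg ?_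
  have := pd_add_pd_succ_le_one (i + k)
  have hx : xw (i + k) = 2 * pd (i + k) + pd (i + k + 1) := rfl
  omega

theorem count_zero_xw_two_mul (j m : ℕ) :
    (factorAt xw (2 * j) (2 * m)).count 0 = 2 * onesCount m j := by
  have h1 := count_zero_xw_add (2 * j) (2 * m)
  have h2 := onesCount_two_mul m j
  have h3 := onesCount_shift (2 * m) (2 * j)
  rw [← mul_add, pd_two_mul, pd_two_mul] at h3
  omega

theorem count_zero_xw_two_mul_add_one (j m : ℕ) :
    (factorAt xw (2 * j) (2 * m + 1)).count 0 = 2 * onesCount m j + pd (j + m) := by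
  have h1 := pd_two_mul (j + m)
  have h2 := pd_two_mul_add_one (j + m)
  rw [count_zero_xw_succ, count_zero_xw_two_mul, ← mul_add]
  have hx : xw (2 * (j + m)) = 2 * pd (2 * (j + m)) + pd (2 * (j + m) + 1) := rfl
  split_ifs <;> omega

theorem count_zero_xw_odd_start (i n : ℕ) : (factorAt xw (2 * i + 1) n).count 0 + pd i =
    (factorAt xw (2 * i) (n + 1)).count 0 := by
  have h1 := pd_two_mul i
  have h2 := pd_two_mul_add_one i
  simp only [count_factorAt, sum_range_succ', add_zero]
  congr 1
  · refine sum_congr rfl fun k _ => ?_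
    rw [show 2 * i + (k + 1) = 2 * i + 1 + k by ring]
  · have hx : xw (2 * i) = 2 * pd (2 * i) + pd (2 * i + 1) := rfl
    split_ifs <;> omega

theorem count_zero_xw_odd_start_two_mul (j m : ℕ) :
    (factorAt xw (2 * j + 1) (2 * m)).count 0 = onesCount m j + onesCount m (j + 1) := by
  have h1 := count_zero_xw_odd_start j (2 * m)
  have h2 := count_zero_xw_two_mul_add_one j m
  have h3 := onesCount_shift m j
  omega

theorem count_zero_xw_odd_start_two_mul_add_one (j m : ℕ) :
    (factorAt xw (2 * j + 1) (2 * m + 1)).count 0 + pd j = 2 * onesCount (m + 1) j := by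
  rw [count_zero_xw_odd_start, ← count_zero_xw_two_mul]
  rfl

/-! ### Extremal counts -/

theorem le_M0_iff (n k : ℕ) : k ≤ M0 n ↔ ∃ i, k ≤ (factorAt xw i n).count 0 := by
  have hne : {k | ∃ i, (factorAt xw i n).count 0 = k}.Nonempty := ⟨_, 0, rfl⟩
  have hb : BddAbove {k | ∃ i, (factorAt xw i n).count 0 = k} :=
    ⟨n, by rintro _ ⟨i, rfl⟩; exact List.count_le_length.trans_eq (length_factorAt _ _ _)⟩
  constructor
  · intro h
    obtain ⟨i, hi⟩ := Nat.sSup_mem hne hb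
    exact ⟨i, h.trans_eq hi.symm⟩
  · rintro ⟨i, hi⟩
    exact hi.trans (le_csSup hb ⟨i, rfl⟩)

theorem m0_le_iff (n k : ℕ) : m0 n ≤ k ↔ ∃ i, (factorAt xw i n).count 0 ≤ k := by
  constructor
  · intro h
    have hne : {k | ∃ i, (factorAt xw i n).count 0 = k}.Nonempty := ⟨_, 0, rfl⟩
    obtain ⟨i, hi⟩ := Nat.sInf_mem hne
    exact ⟨i, hi.trans_le h⟩
  · rintro ⟨i, hi⟩
    exact le_trans (Nat.sInf_le ⟨i, rfl⟩) hi

theorem M0_two_mul {m t : ℕ} (ht : ∀ j, onesCount m j ≤ onesCount m t) :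
    M0 (2 * m) = 2 * onesCount m t := by
  apply le_antisymm
  · obtain ⟨i, hi⟩ := (le_M0_iff _ _).1 le_rfl
    refine hi.trans ?_
    obtain ⟨j, rfl | rfl⟩ := i.even_or_odd'
    · rw [count_zero_xw_two_mul]
      exact Nat.mul_le_mul_left _ (ht j)
    · rw [count_zero_xw_odd_start_two_mul, two_mul]
      exact add_le_add (ht j) (ht _)
  · exact (le_M0_iff _ _).2 ⟨2 * t, (count_zero_xw_two_mul t m).ge⟩

theorem m0_two_mul {m s : ℕ} (hs : ∀ j, onesCount m s ≤ onesCount m j) :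
    m0 (2 * m) = 2 * onesCount m s := by
  apply le_antisymm
  · exact (m0_le_iff _ _).2 ⟨2 * s, (count_zero_xw_two_mul s m).le⟩
  · obtain ⟨i, hi⟩ := (m0_le_iff _ _).1 le_rfl
    refine le_trans ?_ hi
    obtain ⟨j, rfl | rfl⟩ := i.even_or_odd'
    · rw [count_zero_xw_two_mul]
      exact Nat.mul_le_mul_left _ (hs j)
    · rw [count_zero_xw_odd_start_two_mul, two_mul]
      exact add_le_add (hs j) (hs _)

open Classical in
theorem JM0_two_mul {m t : ℕ} (ht : ∀ j, onesCount (m + 1) j ≤ onesCount (m + 1) t) :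
    JM0 (2 * (m + 1)) + (if onesCount (m + 1) t ∈ flatCounts (m + 1) then 1 else 0) = 1 := by
  have key : onesCount (m + 1) t ∈ flatCounts (m + 1) ↔ ¬ M0 (2 * m + 1) < M0 (2 * m + 1 + 1) := by
    rw [not_lt, show 2 * m + 1 + 1 = 2 * (m + 1) by ring, M0_two_mul ht, le_M0_iff,
      max_mem_flatCounts_iff ht]
    constructor
    · rintro ⟨j, h, h0 | h0⟩
      · have := count_zero_xw_odd_start_two_mul_add_one j m
        exact ⟨2 * j + 1, by omega⟩
      · have := count_zero_xw_two_mul_add_one j m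
        have := onesCount_succ m j
        exact ⟨2 * j, by omega⟩
    · rintro ⟨i, hi⟩
      obtain ⟨j, rfl | rfl⟩ := i.even_or_odd'
      · have := count_zero_xw_two_mul_add_one j m
        have := onesCount_succ m j
        have := ht j
        exact ⟨j, by omega, Or.inr (by omega)⟩
      · have := count_zero_xw_odd_start_two_mul_add_one j m
        have := ht j
        exact ⟨j, by omega, Or.inl (by omega)⟩
  rw [show JM0 (2 * (m + 1)) = if M0 (2 * m + 1) < M0 (2 * m + 1 + 1) then 1 else 0 from rfl]
  simp only [key]
  split_ifs <;> rfl

open Classical in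
theorem jm0_two_mul {m s : ℕ} (hs : ∀ j, onesCount m s ≤ onesCount m j) :
    jm0 (2 * m) + (if onesCount m s ∈ flatCounts m then 1 else 0) = 1 := by
  have key : onesCount m s ∈ flatCounts m ↔ ¬ m0 (2 * m) < m0 (2 * m + 1) := by
    rw [not_lt, m0_two_mul hs, m0_le_iff, min_mem_flatCounts_iff hs]
    constructor
    · rintro ⟨j, ⟨h, h0⟩ | ⟨h, h0⟩⟩
      · have := count_zero_xw_two_mul_add_one j m
        exact ⟨2 * j, by omega⟩
      · have := count_zero_xw_odd_start_two_mul_add_one j m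
        have := onesCount_succ' m j
        exact ⟨2 * j + 1, by omega⟩
    · rintro ⟨i, hi⟩
      obtain ⟨j, rfl | rfl⟩ := i.even_or_odd'
      · have := count_zero_xw_two_mul_add_one j m
        have := hs j
        exact ⟨j, Or.inl ⟨by omega, by omega⟩⟩
      · have := count_zero_xw_odd_start_two_mul_add_one j m
        have := onesCount_succ' m j
        have := hs (j + 1)
        exact ⟨j, Or.inr ⟨by omega, by omega⟩⟩
  simp only [jm0, key]
  split_ifs <;> rfl

/-! ### Abelian and 2-abelian classes -/

/-- The invariant of the 2-abelian class of the factor of length `n` at position `i` of `pd`. -/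
def abel2Class (n i : ℕ) : List ℕ → ℕ :=
  fun v => if v.length ≤ 2 then countFactor (factorAt pd i n) v else 0

/-- The abelian class of the factor of length `n` at position `i` of `xw`. -/
def abClass (n i : ℕ) : Multiset ℕ := factorAt xw i n

theorem abel2Complexity_eq (n : ℕ) : abel2Complexity pd n = (Set.range (abel2Class n)).ncard := by
  rw [abel2Complexity]
  congr 1
  ext f
  exact exists_congr fun i => eq_comm

theorem abComplexity_eq (n : ℕ) : abComplexity xw n = (Set.range (abClass n)).ncard := rfl

theorem finite_range_abel2Class (n : ℕ) : (Set.range (abel2Class n)).Finite := by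
  refine (Set.finite_range fun (u : Fin n → Fin 2) (v : List ℕ) =>
    if v.length ≤ 2 then countFactor (List.ofFn fun k => (u k : ℕ)) v else 0).subset ?_
  rintro _ ⟨i, rfl⟩
  refine ⟨fun k => ⟨pd (i + k), Nat.lt_succ_of_le (pd_le_one _)⟩, ?_⟩
  have : (List.ofFn fun k : Fin n => pd (i + k)) = factorAt pd i n := by
    apply List.ext_getElem <;> simp [factorAt]
  simp only [this]
  rfl

theorem abClass_eq_iff (n i j : ℕ) : abClass n i = abClass n j ↔
    (factorAt xw i n).count 0 = (factorAt xw j n).count 0 ∧ onesCount n i = onesCount n j := by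
  rw [abClass, abClass, Multiset.coe_eq_coe, List.perm_iff_count]
  constructor
  · intro h
    exact ⟨h 0, by simpa [count_two_xw] using h 2⟩
  · rintro ⟨h0, h2⟩ a
    have hi := count_zero_xw_add i n
    have hj := count_zero_xw_add j n
    match a with
    | 0 => exact h0
    | 1 => rw [count_one_xw, count_one_xw]; omega
    | 2 => rw [count_two_xw, count_two_xw, h2]
    | a + 3 => rw [count_xw_of_three_le (by omega), count_xw_of_three_le (by omega)]

theorem countFactor_pair {a b : ℕ} (hb : b ≤ 1) (i n : ℕ) :
    countFactor (factorAt pd i (n + 1)) [a, b] = (factorAt xw i n).count (2 * a + b) := by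
  rw [countFactor_factorAt, count_factorAt]
  refine sum_congr (by simp) fun k _ => ?_
  have := pd_le_one (i + k)
  have := pd_le_one (i + k + 1)
  refine if_congr ?_ rfl rfl
  simp only [factorAt, List.length_cons, List.length_nil, List.range_succ, List.range_zero, xw]
  simp
  omega

theorem countFactor_pair_eq_zero {a b : ℕ} (hab : ¬ (a ≤ 1 ∧ b ≤ 1)) (i n : ℕ) :
    countFactor (factorAt pd i n) [a, b] = 0 := by
  rw [countFactor_factorAt]
  refine sum_eq_zero fun k _ => if_neg ?_
  have := pd_le_one (i + k)
  have := pd_le_one (i + k + 1)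
  simp only [factorAt, List.length_cons, List.length_nil, List.range_succ, List.range_zero]
  simp
  omega

theorem countFactor_singleton (a i n : ℕ) :
    countFactor (factorAt pd i n) [a] = ∑ k ∈ range n, if pd (i + k) = a then 1 else 0 := by
  rw [countFactor_factorAt]
  refine sum_congr (by simp) fun k _ => ?_
  simp [factorAt]

theorem countFactor_one (i n : ℕ) : countFactor (factorAt pd i n) [1] = onesCount n i := by
  rw [countFactor_singleton, onesCount]
  refine sum_congr rfl fun k _ => ?_
  have := pd_le_one (i + k)
  split_ifs <;> omega

theorem countFactor_zero_add_onesCount (i n : ℕ) :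
    countFactor (factorAt pd i n) [0] + onesCount n i = n := by
  rw [countFactor_singleton, onesCount, ← sum_add_distrib]
  trans ∑ k ∈ range n, 1
  · refine sum_congr rfl fun k _ => ?_
    have := pd_le_one (i + k)
    split_ifs <;> omega
  · simp

theorem countFactor_singleton_eq_zero {a : ℕ} (ha : 2 ≤ a) (i n : ℕ) :
    countFactor (factorAt pd i n) [a] = 0 := by
  rw [countFactor_singleton]
  refine sum_eq_zero fun k _ => if_neg ?_
  have := pd_le_one (i + k)
  omega

theorem abel2Class_eq_iff_last (n i j : ℕ) : abel2Class (n + 1) i = abel2Class (n + 1) j ↔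
    abClass n i = abClass n j ∧ pd (i + n) = pd (j + n) := by
  constructor
  · intro h
    have h00 : countFactor _ [0, 0] = countFactor _ [0, 0] := congrFun h [0, 0]
    have h10 : countFactor _ [1, 0] = countFactor _ [1, 0] := congrFun h [1, 0]
    have h1 : countFactor _ [1] = countFactor _ [1] := congrFun h [1]
    rw [countFactor_pair zero_le_one,
      countFactor_pair zero_le_one] at h00 h10
    rw [mul_one, add_zero, count_two_xw, count_two_xw] at h10
    rw [countFactor_one, countFactor_one, onesCount_succ, onesCount_succ] at h1
    exact ⟨(abClass_eq_iff n i j).2 ⟨h00, h10⟩, by omega⟩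
  · rintro ⟨h, he⟩
    have hcount : ∀ a, (factorAt xw i n).count a = (factorAt xw j n).count a :=
      List.perm_iff_count.1 (Multiset.coe_eq_coe.1 h)
    have hones : onesCount (n + 1) i = onesCount (n + 1) j := by
      rw [onesCount_succ, onesCount_succ, he, ((abClass_eq_iff n i j).1 h).2]
    funext v
    match v with
    | [] => simp only [abel2Class, countFactor_factorAt]; rfl
    | [0] =>
      have hi := countFactor_zero_add_onesCount i (n + 1)
      have hj := countFactor_zero_add_onesCount j (n + 1)
      simp only [abel2Class]
      split_ifs <;> omega
    | [1] => simp [abel2Class, countFactor_one, hones]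
    | [a + 2] => simp [abel2Class, countFactor_singleton_eq_zero]
    | [a, b] =>
      by_cases hab : a ≤ 1 ∧ b ≤ 1
      · simp [abel2Class, countFactor_pair hab.2, hcount]
      · simp [abel2Class, countFactor_pair_eq_zero hab]
    | a :: b :: c :: v => simp [abel2Class]

/-- The positions `i` such that the factor of length `n + 1` at `i` of `pd` starts and ends
with `1`. -/
def onesEnds (n : ℕ) : Set ℕ := {i | pd i = 1 ∧ pd (i + n) = 1}

theorem abel2Class_eq_iff (n i j : ℕ) : abel2Class (n + 1) i = abel2Class (n + 1) j ↔
    abClass n i = abClass n j ∧ (i ∈ onesEnds n ↔ j ∈ onesEnds n) := by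
  rw [abel2Class_eq_iff_last, and_congr_right_iff, abClass_eq_iff]
  rintro ⟨h0, h2⟩
  have := count_zero_xw_add i n
  have := count_zero_xw_add j n
  have := onesCount_shift n i
  have := onesCount_shift n j
  have := pd_le_one i
  have := pd_le_one j
  have := pd_le_one (i + n)
  have := pd_le_one (j + n)
  simp only [onesEnds, Set.mem_ofPred_eq]
  omega

theorem onesEnds_two_mul_add_one (m : ℕ) : onesEnds (2 * m + 1) = ∅ := by
  ext i
  simp only [onesEnds, Set.mem_ofPred_eq, Set.mem_empty_iff_false, iff_false, not_and]
  obtain ⟨j, rfl | rfl⟩ := i.even_or_odd'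
  · simp [pd_two_mul]
  · rw [show 2 * j + 1 + (2 * m + 1) = 2 * (j + m + 1) by ring]
    simp [pd_two_mul]

theorem mem_onesEnds_two_mul_iff (m i : ℕ) : i ∈ onesEnds (2 * m) ↔
    ∃ j, i = 2 * j + 1 ∧ pd j = 0 ∧ pd (j + m) = 0 := by
  obtain ⟨j, rfl | rfl⟩ := i.even_or_odd'
  · constructor
    · rintro ⟨h, -⟩
      simp [pd_two_mul] at h
    · rintro ⟨k, h, -⟩
      omega
  · have h1 := pd_two_mul_add_one j
    have h2 := pd_two_mul_add_one (j + m)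
    rw [onesEnds, Set.mem_ofPred_eq, show 2 * j + 1 + 2 * m = 2 * (j + m) + 1 by ring]
    constructor
    · rintro ⟨_, _⟩
      exact ⟨j, rfl, by omega, by omega⟩
    · rintro ⟨k, h, _, _⟩
      obtain rfl : j = k := by omega
      omega

theorem count_zero_xw_of_flat {m j : ℕ} (h : pd j = 0) (h' : pd (j + m) = 0) :
    (factorAt xw (2 * j + 1) (2 * m)).count 0 = 2 * onesCount m j := by
  have := onesCount_shift m j
  rw [count_zero_xw_odd_start_two_mul]
  omega

theorem exists_not_mem_onesEnds (m : ℕ) : ∀ i ∈ onesEnds (2 * m),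
    ∃ j ∉ onesEnds (2 * m), abClass (2 * m) j = abClass (2 * m) i := by
  intro i hi
  obtain ⟨h1, h2⟩ := id hi
  obtain ⟨j, rfl, h, h'⟩ := (mem_onesEnds_two_mul_iff m i).1 hi
  refine ⟨2 * j, ?_, ?_⟩
  · rw [mem_onesEnds_two_mul_iff]
    rintro ⟨k, hk, -⟩
    omega
  · have h3 := onesCount_shift (2 * m) (2 * j)
    rw [← mul_add, pd_two_mul, pd_two_mul] at h3
    exact (abClass_eq_iff _ _ _).2
      ⟨by rw [count_zero_xw_of_flat h h', count_zero_xw_two_mul], by omega⟩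

theorem ncard_abClass_onesEnds (m : ℕ) :
    (abClass (2 * m) '' onesEnds (2 * m)).ncard = (flatCounts m).ncard := by
  have himg : onesEnds (2 * m) = (2 * · + 1) '' {j | pd j = 0 ∧ pd (j + m) = 0} := by
    ext i
    rw [mem_onesEnds_two_mul_iff]
    exact ⟨fun ⟨j, h, h'⟩ => ⟨j, h', h.symm⟩, fun ⟨j, h', h⟩ => ⟨j, h.symm, h'⟩⟩
  rw [himg, Set.image_image, flatCounts]
  refine ncard_image_eq_of_eq_iff fun i hi j hj => ?_
  rw [abClass_eq_iff, count_zero_xw_of_flat hi.1 hi.2, count_zero_xw_of_flat hj.1 hj.2]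
  have hmem : ∀ k, pd k = 0 ∧ pd (k + m) = 0 → 2 * k + 1 ∈ onesEnds (2 * m) := fun k hk =>
    (mem_onesEnds_two_mul_iff m _).2 ⟨k, rfl, hk⟩
  obtain ⟨hi1, hi2⟩ := hmem i hi
  obtain ⟨hj1, hj2⟩ := hmem j hj
  have ci := count_zero_xw_of_flat hi.1 hi.2
  have cj := count_zero_xw_of_flat hj.1 hj.2
  have := count_zero_xw_add (2 * i + 1) (2 * m)
  have := count_zero_xw_add (2 * j + 1) (2 * m)
  have := onesCount_shift (2 * m) (2 * i + 1)
  have := onesCount_shift (2 * m) (2 * j + 1)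
  omega

theorem stmt14 (n : ℕ) (hn : 1 ≤ n) :
    (Odd n → (abel2Complexity pd (n + 1) : ℤ) - (abComplexity xw n : ℤ) = 0) ∧
    (Even n → 2 * ((abel2Complexity pd (n + 1) : ℤ) - (abComplexity xw n : ℤ)) =
      (D0 n : ℤ) + 2 - 2 * (JM0 n : ℤ) - 2 * (jm0 n : ℤ)) := by
  constructor
  · rintro ⟨m, rfl⟩
    rw [abel2Complexity_eq, abComplexity_eq, ncard_range_of_refinement
      (finite_range_abel2Class _) (abel2Class_eq_iff _) (by simp [onesEnds_two_mul_add_one]),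
      onesEnds_two_mul_add_one]
    simp
  · intro heven
    obtain ⟨m, rfl⟩ := heven.exists_two_nsmul
    rw [smul_eq_mul] at *
    obtain ⟨r, rfl⟩ : ∃ r, m = r + 1 := ⟨m - 1, by omega⟩
    obtain ⟨s, hs⟩ := exists_onesCount_min (r + 1)
    obtain ⟨t, ht⟩ := exists_onesCount_max (r + 1)
    have h1 := ncard_flatCounts (by omega) hs ht
    have h2 := JM0_two_mul ht
    have h3 := jm0_two_mul hs
    have h4 := hs t
    rw [abel2Complexity_eq, abComplexity_eq, ncard_range_of_refinement
      (finite_range_abel2Class _) (abel2Class_eq_iff _) (exists_not_mem_onesEnds _),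
      ncard_abClass_onesEnds, D0, M0_two_mul ht, m0_two_mul hs]
    omega
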